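/- Assume ε ~ N(0, σ²I_{n×n}) and let h(β) = √n·λ·‖β‖₁. Let d ≥ 1 be an integer with d < p/5. If the tuning parameter satisfies λ ≤ ((1−δ_{2d})/8)·σ·√(log(p/(5d))), then the Lasso estimator β̂ satisfies E‖X(β̂ − β*)‖ ≥ ((1−δ_{2d})/(8(1+δ_d)))·σ·√(d·log(p/(5d))), for any target vector β* ∈ ℝ^p. -/

import Mathlib

open MeasureTheory ProbabilityTheory
open scoped ENNReal NNReal

/-- Euclidean norm of a vector in `ℝ^k`. -/
noncomputable def l2norm {k : ℕ} (v : Fin k → ℝ) : ℝ := Real.sqrt (∑ i, (v i) ^ 2)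

/-- The restricted isometry constant `δ_s`: the smallest `δ ≥ 0` such that
`(1-δ)‖β‖ ≤ ‖Xβ‖/√n ≤ (1+δ)‖β‖` for all `s`-sparse `β`. -/
noncomputable def ripConst {n p : ℕ} (X : Matrix (Fin n) (Fin p) ℝ) (s : ℕ) : ℝ :=
  sInf {δ : ℝ | 0 ≤ δ ∧ ∀ b : Fin p → ℝ, Set.ncard {j | b j ≠ 0} ≤ s →
    (1 - δ) * l2norm b ≤ l2norm (X.mulVec b) / Real.sqrt n ∧
      l2norm (X.mulVec b) / Real.sqrt n ≤ (1 + δ) * l2norm b}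

namespace LassoNoiseBarrier

/-- Gaussian integration by parts for a bounded function with bounded derivative. -/
lemma integral_id_mul_gaussianReal {v : ℝ≥0} (hv : v ≠ 0) {f f' : ℝ → ℝ} {C C' : ℝ}
    (hf : ∀ t, HasDerivAt f (f' t) t) (hf'm : Measurable f')
    (hC : ∀ t, |f t| ≤ C) (hC' : ∀ t, |f' t| ≤ C') :
    ∫ t, t * f t ∂gaussianReal 0 v = v * ∫ t, f' t ∂gaussianReal 0 v := by
  have hfc : Continuous f := continuous_iff_continuousAt.2 fun t => (hf t).continuousAt
  have hv' : (v : ℝ) ≠ 0 := by exact_mod_cast hv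
  have hid : Integrable (fun t : ℝ => t * gaussianPDFReal 0 v t) := by
    have h : Integrable (fun t : ℝ => t) (gaussianReal 0 v) :=
      (memLp_id_gaussianReal (μ := 0) (v := v) 1).integrable (by simp)
    rw [gaussianReal_of_var_ne_zero _ hv,
      integrable_withDensity_iff (measurable_gaussianPDF 0 v)
        (Filter.Eventually.of_forall fun _ => gaussianPDF_lt_top)] at h
    simpa [toReal_gaussianPDF] using h
  have hg := integrable_gaussianPDFReal 0 v
  have hpdf : ∀ t, HasDerivAt (gaussianPDFReal 0 v) (-(t / v) * gaussianPDFReal 0 v t) t := by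
    intro t
    have h1 : HasDerivAt (fun x : ℝ => -(x - 0) ^ 2 / (2 * v)) (-(t / v)) t := by
      have := (((hasDerivAt_id t).sub_const 0).pow 2).neg.div_const (2 * (v : ℝ))
      refine this.congr_deriv ?_
      simp
      field_simp
    have h2 := (h1.exp).const_mul (Real.sqrt (2 * Real.pi * v))⁻¹
    refine h2.congr_deriv ?_
    simp only [gaussianPDFReal]
    ring
  have key := integral_mul_deriv_eq_deriv_mul_of_integrable (u := f) (u' := f')
    (v := gaussianPDFReal 0 v) (v' := fun t => -(t / v) * gaussianPDFReal 0 v t)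
    (fun t _ => hf t) (fun t _ => hpdf t)
    (by
      have h : Integrable (fun t => f t * (-(1 / v) * (t * gaussianPDFReal 0 v t))) :=
        (hid.const_mul _).bdd_mul hfc.aestronglyMeasurable
          (Filter.Eventually.of_forall fun t => by simpa using hC t)
      refine h.congr (Filter.Eventually.of_forall fun t => ?_)
      simp only [Pi.mul_apply]
      ring)
    (hg.bdd_mul hf'm.aestronglyMeasurable
      (Filter.Eventually.of_forall fun t => by simpa using hC' t))
    (hg.bdd_mul hfc.aestronglyMeasurable
      (Filter.Eventually.of_forall fun t => by simpa using hC t))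
  rw [integral_gaussianReal_eq_integral_smul hv, integral_gaussianReal_eq_integral_smul hv]
  have h1 : ∫ t, gaussianPDFReal 0 v t • (t * f t)
      = -v * ∫ t, f t * (-(t / v) * gaussianPDFReal 0 v t) := by
    rw [← integral_const_mul]
    congr 1
    ext t
    simp only [smul_eq_mul]
    field_simp
  have h2 : ∫ t, gaussianPDFReal 0 v t • f' t = ∫ t, f' t * gaussianPDFReal 0 v t := by
    simp [mul_comm]
  rw [h1, h2, key]
  ring

lemma integrable_eval_pi_gaussianReal {n : ℕ} (v : ℝ≥0) (i : Fin n) :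
    Integrable (fun g : Fin n → ℝ => g i) (Measure.pi fun _ => gaussianReal 0 v) :=
  integrable_comp_eval (μ := fun _ : Fin n => gaussianReal 0 v) (i := i) (f := fun t => t)
    ((memLp_id_gaussianReal (μ := 0) (v := v) 1).integrable (by simp))

lemma integral_eval_pi_gaussianReal {n : ℕ} (v : ℝ≥0) (i : Fin n) :
    ∫ g : Fin n → ℝ, g i ∂(Measure.pi fun _ => gaussianReal 0 v) = 0 := by
  rw [integral_comp_eval (μ := fun _ : Fin n => gaussianReal 0 v) (i := i) (f := fun t => t)
    (by fun_prop)]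
  exact integral_id_gaussianReal

/-- Coordinatewise Gaussian integration by parts on `ℝⁿ`. -/
lemma integral_eval_mul_pi_gaussianReal {n : ℕ} {v : ℝ≥0} (hv : v ≠ 0) (i : Fin n)
    {F F' : (Fin n → ℝ) → ℝ} {C C' : ℝ} (hF : Measurable F) (hF' : Measurable F')
    (hd : ∀ g t, HasDerivAt (fun s => F (Function.update g i s)) (F' (Function.update g i t)) t)
    (hC : ∀ g, |F g| ≤ C) (hC' : ∀ g, |F' g| ≤ C') :
    ∫ g, g i * F g ∂(Measure.pi fun _ => gaussianReal 0 v)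
      = v * ∫ g, F' g ∂(Measure.pi fun _ => gaussianReal 0 v) := by
  obtain _ | n := n
  · exact i.elim0
  have hmp := (measurePreserving_piFinSuccAbove (fun _ : Fin (n + 1) => gaussianReal 0 v) i).symm
  have h_int1 : Integrable (fun g : Fin (n + 1) → ℝ => g i * F g)
      (Measure.pi fun _ => gaussianReal 0 v) :=
    (integrable_eval_pi_gaussianReal v i).mul_bdd hF.aestronglyMeasurable
      (Filter.Eventually.of_forall fun g => by simpa using hC g)
  have h_int2 : Integrable F' (Measure.pi fun _ : Fin (n + 1) => gaussianReal 0 v) :=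
    Integrable.of_bound hF'.aestronglyMeasurable C'
      (Filter.Eventually.of_forall fun g => by simpa using hC' g)
  have h_int1' := hmp.integrable_comp_of_integrable h_int1
  have h_int2' := hmp.integrable_comp_of_integrable h_int2
  simp only [Function.comp_def] at h_int1' h_int2'
  rw [← hmp.integral_comp', ← hmp.integral_comp', integral_prod_symm _ h_int1',
    integral_prod_symm _ h_int2', ← integral_const_mul]
  congr 1
  ext y
  simp only [MeasurableEquiv.piFinSuccAbove_symm_apply, Fin.insertNthEquiv, Equiv.coe_fn_mk,
    Fin.insertNth_apply_same]
  refine integral_id_mul_gaussianReal hv (fun t => ?_) ?_ (fun t => hC _) (fun t => hC' _)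
  · have := hd (i.insertNth 0 y) t
    simpa [Fin.update_insertNth] using this
  · exact hF'.comp (hmp.measurable.comp (measurable_id.prodMk measurable_const))

section Softmax

variable {n : ℕ} {ι : Type*} [Fintype ι]

/-- Gibbs weights of the linear functionals `x j` at inverse temperature `β`. -/
noncomputable def gibbs (β : ℝ) (x : ι → Fin n → ℝ) (g : Fin n → ℝ) (j : ι) : ℝ :=
  Real.exp (β * (x j ⬝ᵥ g)) / ∑ k, Real.exp (β * (x k ⬝ᵥ g))

lemma continuous_dotProduct_right (y : Fin n → ℝ) : Continuous fun g : Fin n → ℝ => y ⬝ᵥ g := by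
  unfold dotProduct
  fun_prop

lemma gibbs_nonneg (β : ℝ) (x : ι → Fin n → ℝ) (g : Fin n → ℝ) (j : ι) : 0 ≤ gibbs β x g j := by
  unfold gibbs
  positivity

/-- The variance of a finitely supported probability vector `q` on points `x j` that are
`√2 a`-separated is at least `a² ∑ q (1 - q)`. -/
lemma le_variance_of_separated {a : ℝ} {x : ι → Fin n → ℝ}
    (hx : ∀ j k, j ≠ k → 2 * a ^ 2 ≤ ∑ i, (x j i - x k i) ^ 2)
    {q : ι → ℝ} (hq : ∀ j, 0 ≤ q j) (hq1 : ∑ j, q j = 1) :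
    a ^ 2 * ∑ j, q j * (1 - q j) ≤ ∑ j, ∑ i, x j i * (q j * (x j i - ∑ k, q k * x k i)) := by
  classical
  have hpair : ∑ j, ∑ i, x j i * (q j * (x j i - ∑ k, q k * x k i))
      = ∑ j, ∑ k, q j * q k * (∑ i, (x j i - x k i) ^ 2) / 2 := by
    have hcoord : ∀ i, ∑ j, x j i * (q j * (x j i - ∑ k, q k * x k i))
        = ∑ j, ∑ k, q j * q k * (x j i - x k i) ^ 2 / 2 := by
      intro i
      have e1 : ∀ j, ∑ k, q j * q k * (x j i - x k i) ^ 2 / 2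
          = q j * x j i ^ 2 / 2 * (∑ k, q k) - q j * x j i * (∑ k, q k * x k i)
            + q j / 2 * ∑ k, q k * x k i ^ 2 := by
        intro j
        rw [Finset.mul_sum, Finset.mul_sum, Finset.mul_sum, ← Finset.sum_sub_distrib,
          ← Finset.sum_add_distrib]
        exact Finset.sum_congr rfl fun k _ => by ring
      simp_rw [e1, hq1]
      rw [Finset.sum_add_distrib, ← Finset.sum_mul, ← Finset.sum_div, hq1, one_div,
        Finset.mul_sum, ← Finset.sum_add_distrib]
      exact Finset.sum_congr rfl fun j _ => by ring
    rw [Finset.sum_comm, Finset.sum_congr rfl fun i _ => hcoord i, Finset.sum_comm]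
    refine Finset.sum_congr rfl fun j _ => ?_
    rw [Finset.sum_comm]
    refine Finset.sum_congr rfl fun k _ => ?_
    rw [Finset.mul_sum, Finset.sum_div]
  rw [hpair, Finset.mul_sum]
  refine Finset.sum_le_sum fun j _ => ?_
  have h1 : a ^ 2 * (q j * (1 - q j)) = ∑ k, if j = k then 0 else q j * q k * a ^ 2 := by
    have : ∀ k, (if j = k then 0 else q j * q k * a ^ 2)
        = q j * a ^ 2 * q k - if j = k then q j * q k * a ^ 2 else 0 := by
      intro k
      split_ifs <;> ring
    simp_rw [this]
    rw [Finset.sum_sub_distrib, ← Finset.mul_sum, hq1]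
    simp
    ring
  rw [h1]
  refine Finset.sum_le_sum fun k _ => ?_
  split_ifs with h
  · subst h
    simp
  · have := mul_le_mul_of_nonneg_left (hx j k h) (mul_nonneg (hq j) (hq k))
    linarith

variable [Nonempty ι]

lemma partition_pos (β : ℝ) (x : ι → Fin n → ℝ) (g : Fin n → ℝ) :
    0 < ∑ k, Real.exp (β * (x k ⬝ᵥ g)) :=
  Finset.sum_pos (fun _ _ => Real.exp_pos _) Finset.univ_nonempty

lemma sum_gibbs (β : ℝ) (x : ι → Fin n → ℝ) (g : Fin n → ℝ) : ∑ j, gibbs β x g j = 1 := by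
  unfold gibbs
  rw [← Finset.sum_div, div_self (partition_pos β x g).ne']

lemma gibbs_le_one (β : ℝ) (x : ι → Fin n → ℝ) (g : Fin n → ℝ) (j : ι) : gibbs β x g j ≤ 1 := by
  rw [← sum_gibbs β x g]
  exact Finset.single_le_sum (fun k _ => gibbs_nonneg β x g k) (Finset.mem_univ j)

lemma continuous_gibbs (β : ℝ) (x : ι → Fin n → ℝ) (j : ι) :
    Continuous fun g => gibbs β x g j := by
  have h := fun k => continuous_dotProduct_right (x k)
  unfold gibbs
  exact ((h j).const_mul β).rexp.div (continuous_finsetSum _ fun k _ => ((h k).const_mul β).rexp)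
    fun g => (partition_pos β x g).ne'

lemma hasDerivAt_gibbs (β : ℝ) (x : ι → Fin n → ℝ) (g : Fin n → ℝ) (i : Fin n) (j : ι) (t : ℝ) :
    HasDerivAt (fun s => gibbs β x (Function.update g i s) j)
      (β * (gibbs β x (Function.update g i t) j *
        (x j i - ∑ k, gibbs β x (Function.update g i t) k * x k i))) t := by
  have hlin : ∀ k, HasDerivAt (fun s => x k ⬝ᵥ Function.update g i s) (x k i) t := by
    intro k
    have h := HasDerivAt.fun_sum (u := Finset.univ) fun l _ =>
      (hasDerivAt_pi.1 (hasDerivAt_update g i t) l).const_mul (x k l)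
    refine h.congr_deriv ?_
    simp [Pi.single_apply]
  have hexp := fun k => ((hlin k).const_mul β).exp
  have hZ := HasDerivAt.fun_sum (u := Finset.univ) fun k _ => hexp k
  have hne := (partition_pos β x (Function.update g i t)).ne'
  refine ((hexp j).div hZ hne).congr_deriv ?_
  have hsum : ∑ k, gibbs β x (Function.update g i t) k * x k i
      = (∑ k, Real.exp (β * (x k ⬝ᵥ Function.update g i t)) * x k i) /
        ∑ k, Real.exp (β * (x k ⬝ᵥ Function.update g i t)) := by
    unfold gibbs
    rw [Finset.sum_div]
    exact Finset.sum_congr rfl fun k _ => by ring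
  have hsum' : ∑ k, Real.exp (β * (x k ⬝ᵥ Function.update g i t)) * (β * x k i)
      = β * ∑ k, Real.exp (β * (x k ⬝ᵥ Function.update g i t)) * x k i := by
    rw [Finset.mul_sum]
    exact Finset.sum_congr rfl fun k _ => by ring
  rw [hsum, hsum', gibbs]
  field_simp

/-- The largest value of the linear functionals `x j`. -/
noncomputable def maxDot (x : ι → Fin n → ℝ) (g : Fin n → ℝ) : ℝ :=
  Finset.univ.sup' Finset.univ_nonempty fun j => x j ⬝ᵥ g

lemma dotProduct_le_maxDot (x : ι → Fin n → ℝ) (g : Fin n → ℝ) (j : ι) :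
    x j ⬝ᵥ g ≤ maxDot x g :=
  Finset.le_sup' (fun j => x j ⬝ᵥ g) (Finset.mem_univ j)

lemma exists_dotProduct_eq_maxDot (x : ι → Fin n → ℝ) (g : Fin n → ℝ) :
    ∃ j, x j ⬝ᵥ g = maxDot x g := by
  obtain ⟨j, -, hj⟩ := Finset.exists_mem_eq_sup' Finset.univ_nonempty fun j => x j ⬝ᵥ g
  exact ⟨j, hj.symm⟩

lemma continuous_maxDot (x : ι → Fin n → ℝ) : Continuous (maxDot x) :=
  Continuous.finset_sup'_apply _ fun j _ => continuous_dotProduct_right (x j)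

/-- The Gibbs weights are spread out as long as the maximum is small. -/
lemma le_sum_gibbs_mul_one_sub (hcard : 2 ≤ Fintype.card ι) {β : ℝ} (hβ : 0 < β)
    (x : ι → Fin n → ℝ) (g : Fin n → ℝ) :
    (1 - 1 / (Fintype.card ι : ℝ)) *
        (1 + β * ((∑ j, x j ⬝ᵥ g) / Fintype.card ι - maxDot x g) / Real.log (Fintype.card ι))
      ≤ ∑ j, gibbs β x g j * (1 - gibbs β x g j) := by
  set m : ℝ := ((Fintype.card ι : ℕ) : ℝ) with hm
  have hm2 : (2 : ℝ) ≤ m := by rw [hm]; exact_mod_cast hcard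
  have hm0 : 0 < m := by linarith
  have hL : 0 < Real.log m := Real.log_pos (by linarith)
  set Z : ℝ := ∑ k, Real.exp (β * (x k ⬝ᵥ g)) with hZdef
  have hZ : 0 < Z := partition_pos β x g
  set u : ℝ := Real.log Z - β * maxDot x g with hu
  have hexpu : Real.exp (-u) = Real.exp (β * maxDot x g) / Z := by
    rw [hu, neg_sub, Real.exp_sub, Real.exp_log hZ]
  have hgle : ∀ j, gibbs β x g j ≤ Real.exp (-u) := by
    intro j
    rw [hexpu, gibbs]
    have := dotProduct_le_maxDot x g j
    gcongr
  have hu0 : 0 ≤ u := by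
    obtain ⟨j, hj⟩ := exists_dotProduct_eq_maxDot x g
    have h : Real.exp (β * maxDot x g) ≤ Z := by
      rw [← hj]
      exact Finset.single_le_sum (f := fun k => Real.exp (β * (x k ⬝ᵥ g)))
        (fun k _ => (Real.exp_pos _).le) (Finset.mem_univ j)
    have := (Real.le_log_iff_exp_le hZ).2 h
    linarith
  have huL : u ≤ Real.log m := by
    have h : Z ≤ m * Real.exp (β * maxDot x g) := by
      have h' : Z ≤ ∑ _k : ι, Real.exp (β * maxDot x g) := by
        refine Finset.sum_le_sum fun k _ => ?_
        have := dotProduct_le_maxDot x g k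
        gcongr
      simpa [hm] using h'
    have := Real.log_le_log hZ h
    rw [Real.log_mul hm0.ne' (Real.exp_pos _).ne', Real.log_exp] at this
    linarith
  have hjensen : Real.log m + β * ((∑ j, x j ⬝ᵥ g) / m - maxDot x g) ≤ u := by
    have hconv := convexOn_exp.map_sum_le (t := Finset.univ) (w := fun _ : ι => 1 / m)
      (p := fun j => β * (x j ⬝ᵥ g)) (fun _ _ => by positivity)
      (by simp [← hm, hm0.ne']) (fun _ _ => Set.mem_univ _)
    simp only [smul_eq_mul] at hconv
    rw [← Finset.mul_sum, ← Finset.mul_sum, ← Finset.mul_sum, ← hZdef] at hconv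
    have h := Real.log_le_log (Real.exp_pos _) hconv
    rw [Real.log_exp, Real.log_mul (by positivity) hZ.ne', one_div, Real.log_inv] at h
    have e : m⁻¹ * (β * ∑ j, x j ⬝ᵥ g) = β * ((∑ j, x j ⬝ᵥ g) / m) := by ring
    rw [hu, mul_sub]
    linarith
  have hchord : Real.exp (-u) ≤ 1 - (1 - 1 / m) * (u / Real.log m) := by
    have h := convexOn_exp.2 (Set.mem_univ (0 : ℝ)) (Set.mem_univ (-Real.log m))
      (sub_nonneg.2 ((div_le_one hL).2 huL)) (div_nonneg hu0 hL.le) (sub_add_cancel 1 _)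
    have e : (1 - u / Real.log m) • (0 : ℝ) + (u / Real.log m) • (-Real.log m) = -u := by
      simp only [smul_eq_mul]
      field_simp
      ring
    rw [e, Real.exp_neg (Real.log m), Real.exp_log hm0, Real.exp_zero] at h
    simp only [smul_eq_mul] at h
    rw [one_div]
    linarith
  have hspread : 1 - Real.exp (-u) ≤ ∑ j, gibbs β x g j * (1 - gibbs β x g j) := by
    calc 1 - Real.exp (-u) = ∑ j, gibbs β x g j * (1 - Real.exp (-u)) := by
          rw [← Finset.sum_mul, sum_gibbs, one_mul]
      _ ≤ _ := Finset.sum_le_sum fun j _ =>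
          mul_le_mul_of_nonneg_left (by linarith [hgle j]) (gibbs_nonneg β x g j)
  have hfac : 0 ≤ 1 - 1 / m := by
    rw [sub_nonneg, div_le_one hm0]
    linarith
  have hdiv : 1 + β * ((∑ j, x j ⬝ᵥ g) / m - maxDot x g) / Real.log m ≤ u / Real.log m := by
    rw [le_div_iff₀ hL, add_mul, one_mul, div_mul_cancel₀ _ hL.ne']
    exact hjensen
  have := mul_le_mul_of_nonneg_left hdiv hfac
  linarith

lemma integrable_dotProduct_pi_gaussianReal (v : ℝ≥0) (y : Fin n → ℝ) :
    Integrable (fun g : Fin n → ℝ => y ⬝ᵥ g) (Measure.pi fun _ => gaussianReal 0 v) := by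
  unfold dotProduct
  exact integrable_finsetSum _ fun i _ => (integrable_eval_pi_gaussianReal v i).const_mul _

lemma integral_dotProduct_pi_gaussianReal (v : ℝ≥0) (y : Fin n → ℝ) :
    ∫ g : Fin n → ℝ, y ⬝ᵥ g ∂(Measure.pi fun _ => gaussianReal 0 v) = 0 := by
  unfold dotProduct
  rw [integral_finsetSum _ fun i _ => (integrable_eval_pi_gaussianReal v i).const_mul _]
  simp [integral_const_mul, integral_eval_pi_gaussianReal]

lemma integrable_maxDot (v : ℝ≥0) (x : ι → Fin n → ℝ) :
    Integrable (maxDot x) (Measure.pi fun _ => gaussianReal 0 v) := by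
  refine Integrable.mono' (g := fun g => ∑ j, |x j ⬝ᵥ g|)
    (integrable_finsetSum _ fun j _ => (integrable_dotProduct_pi_gaussianReal v (x j)).abs)
    (continuous_maxDot x).aestronglyMeasurable (Filter.Eventually.of_forall fun g => ?_)
  obtain ⟨j, hj⟩ := exists_dotProduct_eq_maxDot x g
  rw [← hj, Real.norm_eq_abs]
  exact Finset.single_le_sum (f := fun j => |x j ⬝ᵥ g|) (fun _ _ => abs_nonneg _)
    (Finset.mem_univ j)

lemma abs_gibbs_mul_sub_le (β : ℝ) (x : ι → Fin n → ℝ) (g : Fin n → ℝ) (i : Fin n) (j : ι) :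
    |gibbs β x g j * (x j i - ∑ k, gibbs β x g k * x k i)| ≤ |x j i| + ∑ k, |x k i| := by
  rw [abs_mul, abs_of_nonneg (gibbs_nonneg β x g j)]
  refine (mul_le_of_le_one_left (abs_nonneg _) (gibbs_le_one β x g j)).trans ?_
  refine (abs_sub _ _).trans (add_le_add le_rfl ?_)
  refine (Finset.abs_sum_le_sum_abs _ _).trans (Finset.sum_le_sum fun k _ => ?_)
  rw [abs_mul, abs_of_nonneg (gibbs_nonneg β x g k)]
  exact mul_le_of_le_one_left (abs_nonneg _) (gibbs_le_one β x g k)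

/-- Integration by parts for the Gibbs average. -/
lemma integral_gibbs_average {v : ℝ≥0} (hv : v ≠ 0) (β : ℝ) (x : ι → Fin n → ℝ) :
    ∫ g, ∑ j, gibbs β x g j * (x j ⬝ᵥ g) ∂(Measure.pi fun _ => gaussianReal 0 v)
      = v * β * ∫ g, ∑ j, ∑ i, x j i * (gibbs β x g j * (x j i - ∑ k, gibbs β x g k * x k i))
        ∂(Measure.pi fun _ => gaussianReal 0 v) := by
  set μ := Measure.pi fun _ : Fin n => gaussianReal 0 v
  have hcont : ∀ j i,
      Continuous fun g => gibbs β x g j * (x j i - ∑ k, gibbs β x g k * x k i) := by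
    intro j i
    have h := fun k => continuous_gibbs β x k
    fun_prop
  have h_int1 : ∀ j i, Integrable (fun g => g i * gibbs β x g j) μ := fun j i =>
    (integrable_eval_pi_gaussianReal v i).mul_bdd (c := 1)
      (continuous_gibbs β x j).aestronglyMeasurable
      (Filter.Eventually.of_forall fun g => by
        rw [Real.norm_eq_abs, abs_of_nonneg (gibbs_nonneg β x g j)]
        exact gibbs_le_one β x g j)
  have h_int2 : ∀ j i, Integrable
      (fun g => gibbs β x g j * (x j i - ∑ k, gibbs β x g k * x k i)) μ := fun j i =>
    Integrable.of_bound (hcont j i).aestronglyMeasurable _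
      (Filter.Eventually.of_forall fun g => by
        rw [Real.norm_eq_abs]
        exact abs_gibbs_mul_sub_le β x g i j)
  have hibp : ∀ j i, ∫ g, g i * gibbs β x g j ∂μ
      = v * (β * ∫ g, gibbs β x g j * (x j i - ∑ k, gibbs β x g k * x k i) ∂μ) := by
    intro j i
    rw [← integral_const_mul]
    refine integral_eval_mul_pi_gaussianReal hv i (F := fun g => gibbs β x g j)
      (C := 1) (C' := |β| * (|x j i| + ∑ k, |x k i|)) (continuous_gibbs β x j).measurable
      ((hcont j i).measurable.const_mul β) (fun g t => hasDerivAt_gibbs β x g i j t)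
      (fun g => ?_) (fun g => ?_)
    · rw [abs_of_nonneg (gibbs_nonneg β x g j)]
      exact gibbs_le_one β x g j
    · rw [abs_mul]
      exact mul_le_mul_of_nonneg_left (abs_gibbs_mul_sub_le β x g i j) (abs_nonneg β)
  have hl : ∀ g : Fin n → ℝ, ∑ j, gibbs β x g j * (x j ⬝ᵥ g)
      = ∑ j, ∑ i, x j i * (g i * gibbs β x g j) := by
    intro g
    refine Finset.sum_congr rfl fun j _ => ?_
    rw [dotProduct, Finset.mul_sum]
    exact Finset.sum_congr rfl fun i _ => by ring
  simp_rw [hl]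
  rw [integral_finsetSum _ fun j _ => integrable_finsetSum _ fun i _ => (h_int1 j i).const_mul _,
    integral_finsetSum _ fun j _ => integrable_finsetSum _ fun i _ => (h_int2 j i).const_mul _,
    Finset.mul_sum]
  refine Finset.sum_congr rfl fun j _ => ?_
  rw [integral_finsetSum _ fun i _ => (h_int1 j i).const_mul _,
    integral_finsetSum _ fun i _ => (h_int2 j i).const_mul _, Finset.mul_sum]
  refine Finset.sum_congr rfl fun i _ => ?_
  rw [integral_const_mul, integral_const_mul, hibp]
  ring

/-- A Sudakov-type minoration: the expected maximum of the Gaussian process indexed by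
`√2 a`-separated points is at least a multiple of `a √(log N)`. -/
lemma le_integral_maxDot {σ : ℝ≥0} (hσ : 0 < σ) (hcard : 5 ≤ Fintype.card ι) {a : ℝ} (ha : 0 < a)
    {x : ι → Fin n → ℝ} (hx : ∀ j k, j ≠ k → 2 * a ^ 2 ≤ ∑ i, (x j i - x k i) ^ 2) :
    σ * a * Real.sqrt (Real.log (Fintype.card ι)) / 4
      ≤ ∫ g, maxDot x g ∂(Measure.pi fun _ => gaussianReal 0 (σ ^ 2)) := by
  set μ := Measure.pi fun _ : Fin n => gaussianReal 0 (σ ^ 2)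
  set m : ℝ := ((Fintype.card ι : ℕ) : ℝ) with hm
  set M := ∫ g, maxDot x g ∂μ with hM
  have hm5 : (5 : ℝ) ≤ m := by rw [hm]; exact_mod_cast hcard
  have hL : 0 < Real.log m := Real.log_pos (by linarith)
  set S := Real.sqrt (Real.log m) with hS
  have hS0 : 0 < S := Real.sqrt_pos.2 hL
  have hSL : Real.log m = S ^ 2 := (Real.sq_sqrt hL.le).symm
  have hσ' : (0 : ℝ) < σ := by exact_mod_cast hσ
  set β : ℝ := 2 * S / (σ * a) with hβdef
  have hβ : 0 < β := by positivity
  have hcg := fun j => continuous_gibbs β x j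
  have hcd := fun j => continuous_dotProduct_right (x j)
  have h_int_avg : Integrable (fun g => (∑ j, x j ⬝ᵥ g) / m) μ :=
    (integrable_finsetSum _ fun j _ => integrable_dotProduct_pi_gaussianReal _ (x j)).div_const m
  have h_intM : Integrable (maxDot x) μ := integrable_maxDot _ x
  have havg : ∫ g, (∑ j, x j ⬝ᵥ g) / m ∂μ = 0 := by
    rw [integral_div, integral_finsetSum _ fun j _ => integrable_dotProduct_pi_gaussianReal _ (x j)]
    simp [integral_dotProduct_pi_gaussianReal]
  have hupper : ∫ g, ∑ j, gibbs β x g j * (x j ⬝ᵥ g) ∂μ ≤ M := by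
    refine integral_mono (integrable_finsetSum _ fun j _ => ?_) h_intM fun g => ?_
    · exact (integrable_dotProduct_pi_gaussianReal _ (x j)).bdd_mul (c := 1)
        (hcg j).aestronglyMeasurable (Filter.Eventually.of_forall fun g => by
          rw [Real.norm_eq_abs, abs_of_nonneg (gibbs_nonneg β x g j)]
          exact gibbs_le_one β x g j)
    · calc ∑ j, gibbs β x g j * (x j ⬝ᵥ g) ≤ ∑ j, gibbs β x g j * maxDot x g :=
            Finset.sum_le_sum fun j _ => mul_le_mul_of_nonneg_left (dotProduct_le_maxDot x g j)
              (gibbs_nonneg β x g j)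
        _ = maxDot x g := by rw [← Finset.sum_mul, sum_gibbs, one_mul]
  have hlower : a ^ 2 * ((1 - 1 / m) * (1 - β * M / S ^ 2)) ≤
      ∫ g, ∑ j, ∑ i, x j i * (gibbs β x g j * (x j i - ∑ k, gibbs β x g k * x k i)) ∂μ := by
    have heq : a ^ 2 * ((1 - 1 / m) * (1 - β * M / S ^ 2)) =
        ∫ g, a ^ 2 * ((1 - 1 / m) *
          (1 + β * ((∑ j, x j ⬝ᵥ g) / m - maxDot x g) / Real.log m)) ∂μ := by
      have h_int : Integrable (fun g => (∑ j, x j ⬝ᵥ g) / m - maxDot x g) μ := h_int_avg.sub h_intM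
      rw [integral_const_mul, integral_const_mul, integral_add (integrable_const _)
        ((h_int.const_mul β).div_const _), integral_div, integral_const_mul,
        integral_sub h_int_avg h_intM, havg, ← hM, ← hSL,
        integral_const, probReal_univ, one_smul]
      ring
    rw [heq]
    refine integral_mono ?_ ?_ fun g => ?_
    · exact (((integrable_const _).add
        (((h_int_avg.sub h_intM).const_mul β).div_const _)).const_mul _).const_mul _
    · refine integrable_finsetSum _ fun j _ => integrable_finsetSum _ fun i _ => ?_
      refine Integrable.of_bound (C := |x j i| * (|x j i| + ∑ k, |x k i|)) ?_
        (Filter.Eventually.of_forall fun g => ?_)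
      · exact Continuous.aestronglyMeasurable (by fun_prop)
      · rw [Real.norm_eq_abs, abs_mul]
        exact mul_le_mul_of_nonneg_left (abs_gibbs_mul_sub_le β x g i j) (abs_nonneg _)
    · exact (mul_le_mul_of_nonneg_left
        (le_sum_gibbs_mul_one_sub (by omega) hβ x g) (sq_nonneg a)).trans
        (le_variance_of_separated hx (fun j => gibbs_nonneg β x g j) (sum_gibbs β x g))
  rw [integral_gibbs_average (by positivity)] at hupper
  have hmain : ((σ ^ 2 : ℝ≥0) : ℝ) * β * (a ^ 2 * ((1 - 1 / m) * (1 - β * M / S ^ 2))) ≤ M :=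
    (mul_le_mul_of_nonneg_left hlower (by positivity)).trans hupper
  by_contra! hlt
  have h1 : 1 / 2 ≤ 1 - β * M / S ^ 2 := by
    have : β * M / S ^ 2 ≤ 1 / 2 := by
      rw [hβdef, div_le_iff₀ (by positivity), div_mul_eq_mul_div, div_le_iff₀ (by positivity)]
      nlinarith
    linarith
  have h2 : 4 / 5 ≤ 1 - 1 / m := by
    have : 1 / m ≤ 1 / 5 := one_div_le_one_div_of_le (by norm_num) hm5
    linarith
  have h3 : 2 / 5 ≤ (1 - 1 / m) * (1 - β * M / S ^ 2) := by nlinarith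
  have h4 : ((σ ^ 2 : ℝ≥0) : ℝ) * β * a ^ 2 = 2 * (σ * a * S) := by
    rw [hβdef]
    push_cast
    field_simp
  have h5 : 0 < σ * a * S := by positivity
  rw [← mul_assoc, h4] at hmain
  nlinarith

end Softmax

lemma l2norm_nonneg {k : ℕ} (v : Fin k → ℝ) : 0 ≤ l2norm v := Real.sqrt_nonneg _

lemma l2norm_sq {k : ℕ} (v : Fin k → ℝ) : l2norm v ^ 2 = ∑ i, v i ^ 2 :=
  Real.sq_sqrt (Finset.sum_nonneg fun _ _ => sq_nonneg _)

lemma l2norm_sq_eq_dotProduct {k : ℕ} (v : Fin k → ℝ) : l2norm v ^ 2 = v ⬝ᵥ v := by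
  rw [l2norm_sq, dotProduct]
  exact Finset.sum_congr rfl fun i _ => sq (v i)

lemma dotProduct_le_l2norm_mul {k : ℕ} (v w : Fin k → ℝ) : v ⬝ᵥ w ≤ l2norm v * l2norm w :=
  Real.sum_mul_le_sqrt_mul_sqrt _ _ _

lemma l2norm_add_sq {k : ℕ} (v w : Fin k → ℝ) :
    l2norm (v + w) ^ 2 = l2norm v ^ 2 + 2 * (v ⬝ᵥ w) + l2norm w ^ 2 := by
  simp only [l2norm_sq_eq_dotProduct, dotProduct_add, add_dotProduct, dotProduct_comm w v]
  ring

lemma continuous_l2norm {k : ℕ} : Continuous (l2norm : (Fin k → ℝ) → ℝ) := by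
  unfold l2norm
  fun_prop

lemma l2norm_le_sum_abs {k : ℕ} (v : Fin k → ℝ) : l2norm v ≤ ∑ i, |v i| := by
  refine Real.sqrt_le_iff.2 ⟨Finset.sum_nonneg fun _ _ => abs_nonneg _, ?_⟩
  have := Finset.sum_sq_le_sq_sum_of_nonneg (s := Finset.univ) (f := fun i => |v i|)
    fun _ _ => abs_nonneg _
  simpa [sq_abs] using this

section RestrictedIsometry

variable {n p : ℕ}

lemma exists_l2norm_mulVec_le (X : Matrix (Fin n) (Fin p) ℝ) :
    ∃ C, 0 ≤ C ∧ ∀ b, l2norm (X.mulVec b) ≤ C * l2norm b := by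
  refine ⟨Real.sqrt (∑ i, l2norm (X i) ^ 2), Real.sqrt_nonneg _, fun b => ?_⟩
  rw [l2norm, Real.sqrt_le_iff]
  refine ⟨mul_nonneg (Real.sqrt_nonneg _) (l2norm_nonneg b), ?_⟩
  rw [mul_pow, Real.sq_sqrt (Finset.sum_nonneg fun _ _ => sq_nonneg _), Finset.sum_mul]
  refine Finset.sum_le_sum fun i _ => ?_
  rw [← mul_pow, ← sq_abs]
  refine pow_le_pow_left₀ (abs_nonneg _) (abs_le.2 ⟨?_, dotProduct_le_l2norm_mul (X i) b⟩) 2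
  have h := dotProduct_le_l2norm_mul (X i) (-b)
  rw [dotProduct_neg] at h
  have e : l2norm (-b) = l2norm b := by simp [l2norm]
  rw [e] at h
  have : X.mulVec b i = X i ⬝ᵥ b := rfl
  linarith

/-- The infimum defining the restricted isometry constant is attained. -/
lemma ripConst_spec (X : Matrix (Fin n) (Fin p) ℝ) (s : ℕ) :
    0 ≤ ripConst X s ∧ ∀ b : Fin p → ℝ, Set.ncard {j | b j ≠ 0} ≤ s →
      (1 - ripConst X s) * l2norm b ≤ l2norm (X.mulVec b) / Real.sqrt n ∧
        l2norm (X.mulVec b) / Real.sqrt n ≤ (1 + ripConst X s) * l2norm b := by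
  refine IsClosed.csInf_mem (s := {δ : ℝ | 0 ≤ δ ∧ ∀ b : Fin p → ℝ, Set.ncard {j | b j ≠ 0} ≤ s →
    (1 - δ) * l2norm b ≤ l2norm (X.mulVec b) / Real.sqrt n ∧
      l2norm (X.mulVec b) / Real.sqrt n ≤ (1 + δ) * l2norm b}) ?_ ?_ ⟨0, fun δ hδ => hδ.1⟩
  · simp only [Set.ofPred_and, Set.ofPred_forall]
    refine (isClosed_le continuous_const continuous_id).inter
      (isClosed_iInter fun b => isClosed_iInter fun _ => IsClosed.inter ?_ ?_)
    · exact isClosed_le (by fun_prop) continuous_const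
    · exact isClosed_le continuous_const (by fun_prop)
  · obtain ⟨C, hC, hX⟩ := exists_l2norm_mulVec_le X
    refine ⟨1 + C / Real.sqrt n, by positivity, fun b _ => ⟨?_, ?_⟩⟩
    · have h1 : 0 ≤ l2norm (X.mulVec b) / Real.sqrt n :=
        div_nonneg (l2norm_nonneg _) (Real.sqrt_nonneg _)
      have h2 : 0 ≤ C / Real.sqrt n * l2norm b :=
        mul_nonneg (div_nonneg hC (Real.sqrt_nonneg _)) (l2norm_nonneg b)
      linarith
    · have h1 : l2norm (X.mulVec b) / Real.sqrt n ≤ C * l2norm b / Real.sqrt n :=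
        div_le_div_of_nonneg_right (hX b) (Real.sqrt_nonneg _)
      have h2 : C * l2norm b / Real.sqrt n = C / Real.sqrt n * l2norm b := by ring
      have h3 := l2norm_nonneg b
      linarith

lemma ncard_support_single_sub_single_le (j k : Fin p) :
    Set.ncard {l | (Pi.single j (1 : ℝ) - Pi.single k (1 : ℝ) : Fin p → ℝ) l ≠ 0} ≤ 2 := by
  refine (Set.ncard_le_ncard (t := {j, k}) (fun l hl => ?_) (Set.toFinite _)).trans
    ((Set.ncard_insert_le j {k}).trans (by simp))
  by_contra h
  simp only [Set.mem_insert_iff, Set.mem_singleton_iff, not_or] at h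
  exact hl (by simp [h.1, h.2])

/-- Distinct columns of a matrix are separated when its restricted isometry constant is small. -/
lemma le_sum_sq_column_sub {X : Matrix (Fin n) (Fin p) ℝ} {s : ℕ} (hs : 2 ≤ s) (hn : 0 < n)
    (hδ : 0 ≤ 1 - ripConst X s) {j k : Fin p} (hjk : j ≠ k) :
    2 * (Real.sqrt n * (1 - ripConst X s)) ^ 2 ≤ ∑ i, (X i j - X i k) ^ 2 := by
  set b : Fin p → ℝ := Pi.single j (1 : ℝ) - Pi.single k (1 : ℝ) with hb
  have hsn : 0 < Real.sqrt n := Real.sqrt_pos.2 (by exact_mod_cast hn)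
  have h := ((ripConst_spec X s).2 b ((ncard_support_single_sub_single_le j k).trans hs)).1
  rw [le_div_iff₀ hsn] at h
  have hbn : l2norm b ^ 2 = 2 := by
    rw [l2norm_sq_eq_dotProduct, hb]
    simp [dotProduct_sub, hjk, hjk.symm]
    norm_num
  have hXb : l2norm (X.mulVec b) ^ 2 = ∑ i, (X i j - X i k) ^ 2 := by
    rw [l2norm_sq]
    simp [hb, Matrix.mulVec_sub]
  have h2 := pow_le_pow_left₀
    (mul_nonneg (mul_nonneg hδ (l2norm_nonneg b)) hsn.le) h 2
  rw [hXb, mul_pow, mul_pow, hbn] at h2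
  rw [mul_pow]
  linarith

/-- Zero-one vectors with `d` ones. -/
lemma exists_indicator_vector (X : Matrix (Fin n) (Fin p) ℝ) {d : ℕ} (f : Fin d → Fin p)
    (hf : Function.Injective f) :
    ∃ u : Fin p → ℝ, ∑ j, |u j| = d ∧ l2norm u = Real.sqrt d ∧
      Set.ncard {j | u j ≠ 0} ≤ d ∧
      ∀ e : Fin n → ℝ, X.mulVec u ⬝ᵥ e = ∑ k, (fun i => X i (f k)) ⬝ᵥ e := by
  classical
  set S : Finset (Fin p) := Finset.univ.map ⟨f, hf⟩ with hS
  have hcard : S.card = d := by simp [hS]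
  refine ⟨fun j => if j ∈ S then 1 else 0, ?_, ?_, ?_, fun e => ?_⟩
  · simp [apply_ite abs, hcard]
  · simp [l2norm, hcard]
  · have : {j | (if j ∈ S then (1 : ℝ) else 0) ≠ 0} = (S : Set (Fin p)) := by
      ext j
      simp
    rw [this, Set.ncard_coe_finset, hcard]
  · have h1 : X.mulVec (fun j => if j ∈ S then 1 else 0) = ∑ k, fun i => X i (f k) := by
      ext i
      simp only [Matrix.mulVec, dotProduct, mul_ite, mul_one, mul_zero, Finset.sum_ite_mem,
        Finset.univ_inter, Finset.sum_apply]
      rw [hS, Finset.sum_map]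
      rfl
    rw [h1, sum_dotProduct]

/-- A random variable that dominates the penalized noise in every direction has large expectation
when the penalty level is small. -/
lemma le_integral_of_forall_noise_le (X : Matrix (Fin n) (Fin p) ℝ) {Ω : Type*}
    [MeasurableSpace Ω] {P : Measure Ω} [IsProbabilityMeasure P]
    {σ : ℝ≥0} (hσ : 0 < σ) {ε : Ω → Fin n → ℝ} (hmeas : Measurable ε)
    (hgauss : Measure.map ε P = Measure.pi fun _ : Fin n => gaussianReal 0 (σ ^ 2))
    {lam : ℝ} {d : ℕ} (hd : 1 ≤ d) (hdp : 5 * d < p) (hn : 0 < n)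
    (hδ : 0 < 1 - ripConst X (2 * d))
    (hlam : lam ≤ (1 - ripConst X (2 * d)) / 8 * σ * Real.sqrt (Real.log (p / (5 * d))))
    {R : Ω → ℝ} (hR : Integrable R P) (hR0 : ∀ ω, 0 ≤ R ω)
    (hdom : ∀ ω u, X.mulVec u ⬝ᵥ ε ω - Real.sqrt n * lam * ∑ j, |u j| ≤
      R ω * l2norm (X.mulVec u)) :
    (1 - ripConst X (2 * d)) / (8 * (1 + ripConst X d)) * σ *
        Real.sqrt (d * Real.log (p / (5 * d))) ≤ ∫ ω, R ω ∂P := by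
  have hsn : 0 < Real.sqrt n := Real.sqrt_pos.2 (by exact_mod_cast hn)
  have hd0 : (0 : ℝ) < d := by exact_mod_cast hd
  set δ := ripConst X (2 * d)
  set δ' := ripConst X d with hδ'
  have hδ'0 : 0 ≤ δ' := (ripConst_spec X d).1
  set m : ℕ := p / d with hm
  have hm5 : 5 ≤ m := (Nat.le_div_iff_mul_le hd).2 hdp.le
  have : NeZero m := ⟨by omega⟩
  have hdm : d * m ≤ p := Nat.mul_div_le p d
  let block : Fin d × Fin m → Fin p := fun q => Fin.castLE hdm (finProdFinEquiv q)
  have hblock : Function.Injective block :=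
    (Fin.castLE_injective hdm).comp finProdFinEquiv.injective
  let x : Fin d → Fin m → Fin n → ℝ := fun k j i => X i (block (k, j))
  have hmax : ∀ k, σ * (Real.sqrt n * (1 - δ)) * Real.sqrt (Real.log m) / 4
      ≤ ∫ ω, maxDot (x k) (ε ω) ∂P := by
    intro k
    have h := le_integral_maxDot hσ (x := x k) (a := Real.sqrt n * (1 - δ))
      (by simpa using hm5) (mul_pos hsn hδ) fun j j' hjj' =>
        le_sum_sq_column_sub (by omega) hn hδ.le
          (fun h => hjj' (by simpa using hblock h))
    rw [← hgauss, integral_map hmeas.aemeasurable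
      (continuous_maxDot (x k)).aestronglyMeasurable] at h
    simpa using h
  have h_int : ∀ k, Integrable (fun ω => maxDot (x k) (ε ω)) P := by
    intro k
    have h := integrable_maxDot (σ ^ 2) (x k)
    rw [← hgauss] at h
    exact h.comp_measurable hmeas
  have hpt : ∀ ω, ∑ k, maxDot (x k) (ε ω) - Real.sqrt n * lam * d
      ≤ R ω * ((1 + δ') * Real.sqrt d * Real.sqrt n) := by
    intro ω
    choose j hj using fun k => exists_dotProduct_eq_maxDot (x k) (ε ω)
    have hf : Function.Injective fun k => block (k, j k) := fun k k' h =>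
      congrArg Prod.fst (hblock h)
    obtain ⟨u, hu1, hu2, hu3, hu4⟩ := exists_indicator_vector X _ hf
    have h := hdom ω u
    rw [hu1, hu4, Finset.sum_congr rfl fun k _ => hj k] at h
    refine h.trans (mul_le_mul_of_nonneg_left ?_ (hR0 ω))
    have := ((ripConst_spec X d).2 u hu3).2
    rw [div_le_iff₀ hsn, hu2] at this
    exact this
  have hE : d * (σ * (Real.sqrt n * (1 - δ)) * Real.sqrt (Real.log m) / 4) - Real.sqrt n * lam * d
      ≤ (∫ ω, R ω ∂P) * ((1 + δ') * Real.sqrt d * Real.sqrt n) := by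
    have h := integral_mono (((integrable_finsetSum _ fun k _ => h_int k).sub
      (integrable_const (Real.sqrt n * lam * d)))) (hR.mul_const _) hpt
    simp only [Pi.sub_apply] at h
    rw [integral_sub (integrable_finsetSum _ fun k _ => h_int k) (integrable_const _),
      integral_finsetSum _ fun k _ => h_int k, integral_const, probReal_univ, one_smul,
      integral_mul_const] at h
    have h2 := Finset.sum_le_sum fun k (_ : k ∈ Finset.univ) => hmax k
    rw [Finset.sum_const, Finset.card_univ, Fintype.card_fin, nsmul_eq_mul] at h2
    linarith
  have hlogle : Real.sqrt (Real.log (p / (5 * d))) ≤ Real.sqrt (Real.log m) := by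
    refine Real.sqrt_le_sqrt (Real.log_le_log (by
      have : (0 : ℝ) < p := by exact_mod_cast (by omega : 0 < p)
      positivity) ?_)
    rw [div_le_iff₀ (by positivity)]
    have h1 : p < d * (m + 1) := Nat.lt_mul_div_succ p hd
    have h2 : p ≤ m * (5 * d) := by nlinarith
    exact_mod_cast h2
  set T := Real.sqrt (Real.log (p / (5 * d))) with hT
  have hσ' : (0 : ℝ) < σ := by exact_mod_cast hσ
  have hcombine : d * (Real.sqrt n * ((1 - δ) * σ * T / 8))
      ≤ (∫ ω, R ω ∂P) * ((1 + δ') * Real.sqrt d * Real.sqrt n) := by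
    have h1 : d * (σ * (Real.sqrt n * (1 - δ)) * T / 4)
        ≤ d * (σ * (Real.sqrt n * (1 - δ)) * Real.sqrt (Real.log m) / 4) := by
      gcongr
    have h2 : Real.sqrt n * lam * d ≤ Real.sqrt n * ((1 - δ) / 8 * σ * T) * d := by
      gcongr
    linarith
  rw [Real.sqrt_mul hd0.le, ← hT]
  have hsd : 0 < Real.sqrt d := Real.sqrt_pos.2 hd0
  have hdd : Real.sqrt d * Real.sqrt d = d := Real.mul_self_sqrt hd0.le
  have hcancel : (1 - δ) * σ * T / 8 * Real.sqrt d ≤ (∫ ω, R ω ∂P) * (1 + δ') := by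
    refine le_of_mul_le_mul_right ?_ (mul_pos hsd hsn)
    calc (1 - δ) * σ * T / 8 * Real.sqrt d * (Real.sqrt d * Real.sqrt n)
        = Real.sqrt d * Real.sqrt d * (Real.sqrt n * ((1 - δ) * σ * T / 8)) := by ring
      _ ≤ _ := by
        rw [hdd]
        linarith
  calc (1 - δ) / (8 * (1 + δ')) * σ * (Real.sqrt d * T)
      = ((1 - δ) * σ * T / 8 * Real.sqrt d) / (1 + δ') := by
        field_simp
    _ ≤ _ := (div_le_iff₀ (by positivity)).2 hcancel

end RestrictedIsometry

section Lasso

variable {n p : ℕ}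

lemma nonneg_of_forall_pos_quadratic {a q : ℝ} (h : ∀ t > 0, 0 ≤ 2 * t * a + t ^ 2 * q) :
    0 ≤ a := by
  have hlim : Filter.Tendsto (fun t : ℝ => 2 * a + t * q) (nhdsWithin 0 (Set.Ioi 0))
      (nhds (2 * a + 0 * q)) :=
    (Continuous.tendsto (by fun_prop) 0).mono_left nhdsWithin_le_nhds
  have h0 : 0 ≤ 2 * a + 0 * q := by
    refine ge_of_tendsto hlim ?_
    filter_upwards [self_mem_nhdsWithin] with t ht
    have ht' : 0 < t := ht
    have := h t ht
    exact nonneg_of_mul_nonneg_right (by linarith : 0 ≤ t * (2 * a + t * q)) ht'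
  linarith

/-- First-order optimality for least squares with a multiple of the `ℓ¹` norm added, when the
penalty grows at most linearly in the direction `u`. -/
lemma noise_sub_le_of_minimizer {X : Matrix (Fin n) (Fin p) ℝ} {bs b : Fin p → ℝ}
    {e : Fin n → ℝ} {c : ℝ}
    (hmin : ∀ b' : Fin p → ℝ, l2norm (X.mulVec b - (X.mulVec bs + e)) ^ 2 + 2 * (c * ∑ j, |b j|) ≤
      l2norm (X.mulVec b' - (X.mulVec bs + e)) ^ 2 + 2 * (c * ∑ j, |b' j|))
    {u : Fin p → ℝ} {D : ℝ}
    (hD : ∀ t > 0, c * ∑ j, |(b + t • u) j| ≤ c * ∑ j, |b j| + t * D) :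
    X.mulVec u ⬝ᵥ e - D ≤ X.mulVec (b - bs) ⬝ᵥ X.mulVec u := by
  set r := X.mulVec b - (X.mulVec bs + e) with hr
  have hru : r ⬝ᵥ X.mulVec u = X.mulVec (b - bs) ⬝ᵥ X.mulVec u - X.mulVec u ⬝ᵥ e := by
    rw [hr, Matrix.mulVec_sub, sub_dotProduct, sub_dotProduct, add_dotProduct, dotProduct_comm e]
    ring
  have hquad : 0 ≤ r ⬝ᵥ X.mulVec u + D := by
    refine nonneg_of_forall_pos_quadratic (q := l2norm (X.mulVec u) ^ 2) fun t ht => ?_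
    have h := hmin (b + t • u)
    have e1 : X.mulVec (b + t • u) - (X.mulVec bs + e) = r + t • X.mulVec u := by
      rw [Matrix.mulVec_add, Matrix.mulVec_smul, hr]
      abel
    rw [e1, l2norm_add_sq, dotProduct_smul, smul_eq_mul] at h
    have e2 : l2norm (t • X.mulVec u) ^ 2 = t ^ 2 * l2norm (X.mulVec u) ^ 2 := by
      simp only [l2norm_sq_eq_dotProduct, smul_dotProduct, dotProduct_smul, smul_eq_mul]
      ring
    have h3 := hD t ht
    linarith
  linarith

lemma exists_sign_vector (b : Fin p → ℝ) :
    ∃ s : Fin p → ℝ, s ⬝ᵥ b = ∑ j, |b j| ∧ ∀ u : Fin p → ℝ, s ⬝ᵥ u ≤ ∑ j, |u j| := by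
  refine ⟨fun j => if 0 ≤ b j then 1 else -1, ?_, fun u => ?_⟩
  · refine Finset.sum_congr rfl fun j _ => ?_
    dsimp only
    split_ifs with h
    · rw [one_mul, abs_of_nonneg h]
    · rw [neg_one_mul, abs_of_neg (not_le.1 h)]
  · refine Finset.sum_le_sum fun j _ => ?_
    dsimp only
    split_ifs
    · rw [one_mul]
      exact le_abs_self _
    · rw [neg_one_mul]
      exact neg_le_abs _

lemma sum_abs_le_mul_l2norm (b : Fin p → ℝ) : ∑ j, |b j| ≤ p * l2norm b := by
  have h : ∀ j ∈ Finset.univ, |b j| ≤ l2norm b := fun j _ => by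
    refine Real.abs_le_sqrt ?_
    exact Finset.single_le_sum (f := fun j => b j ^ 2) (fun _ _ => sq_nonneg _) (Finset.mem_univ j)
  simpa using Finset.sum_le_card_nsmul _ _ _ h

/-- The Moore–Penrose inverse of a matrix with independent columns. -/
lemma exists_pseudoinverse {X : Matrix (Fin n) (Fin p) ℝ}
    (hX : ∀ v, X.mulVec v = 0 → v = 0) :
    ∃ A : Matrix (Fin p) (Fin n) ℝ, (∀ b, A.mulVec (X.mulVec b) = b) ∧
      ∀ e u, X.mulVec (A.mulVec e) ⬝ᵥ X.mulVec u = e ⬝ᵥ X.mulVec u := by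
  have hadj : ∀ (v : Fin n → ℝ) u, v ⬝ᵥ X.mulVec u = X.transpose.mulVec v ⬝ᵥ u := by
    intro v u
    rw [Matrix.dotProduct_mulVec, Matrix.mulVec_transpose]
  have hinj : Function.Injective (X.transpose * X).mulVec := by
    refine (injective_iff_map_eq_zero (X.transpose * X).mulVecLin).2 fun v hv => hX v ?_
    rw [Matrix.mulVecLin_apply, ← Matrix.mulVec_mulVec] at hv
    rw [← dotProduct_self_eq_zero, hadj, hv, zero_dotProduct]
  have hunit := Matrix.mulVec_injective_iff_isUnit.1 hinj
  have hdet := (Matrix.isUnit_iff_isUnit_det _).1 hunit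
  refine ⟨(X.transpose * X)⁻¹ * X.transpose, fun b => ?_, fun e u => ?_⟩
  · rw [Matrix.mulVec_mulVec, Matrix.mul_assoc, Matrix.nonsing_inv_mul _ hdet, Matrix.one_mulVec]
  · rw [hadj, hadj, Matrix.mulVec_mulVec, Matrix.mulVec_mulVec, ← Matrix.mul_assoc,
      Matrix.mul_nonsing_inv _ hdet, Matrix.one_mul]

lemma integral_pi_gaussianReal_eq_zero_of_odd {v : ℝ≥0} {f : (Fin n → ℝ) → ℝ}
    (hodd : ∀ g, f (-g) = -f g) :
    ∫ g, f g ∂(Measure.pi fun _ => gaussianReal 0 v) = 0 := by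
  have hmap : (Measure.pi fun _ : Fin n => gaussianReal 0 v).map (MeasurableEquiv.neg _)
      = Measure.pi fun _ => gaussianReal 0 v := by
    have hneg : (gaussianReal 0 v).map (fun t => -t) = gaussianReal 0 v := by
      rw [gaussianReal_map_neg, neg_zero]
    have : ∀ _ : Fin n, SigmaFinite ((gaussianReal 0 v).map fun t => -t) := fun _ => by
      rw [hneg]
      infer_instance
    have h := Measure.pi_map_pi (μ := fun _ : Fin n => gaussianReal 0 v) (f := fun _ t => -t)
      fun _ => measurable_neg.aemeasurable
    rw [hneg] at h
    exact h
  have h := integral_map_equiv (μ := Measure.pi fun _ : Fin n => gaussianReal 0 v)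
    (MeasurableEquiv.neg (Fin n → ℝ)) f
  rw [hmap] at h
  have e : ∀ g : Fin n → ℝ, f (MeasurableEquiv.neg (Fin n → ℝ) g) = -f g := hodd
  simp_rw [e] at h
  rw [integral_neg] at h
  linarith

/-- Least squares minus a multiple of the `ℓ¹` norm attains its minimum when the design is
injective. -/
lemma exists_minimizer {X : Matrix (Fin n) (Fin p) ℝ} {K : ℝ}
    (hK : ∀ b : Fin p → ℝ, ∑ j, |b j| ≤ K * l2norm (X.mulVec b)) (y : Fin n → ℝ)
    {γ : ℝ} (hγ : 0 ≤ γ) :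
    ∃ b : Fin p → ℝ, ∀ b' : Fin p → ℝ,
      l2norm (X.mulVec b - y) ^ 2 - 2 * γ * ∑ j, |b j| ≤
        l2norm (X.mulVec b' - y) ^ 2 - 2 * γ * ∑ j, |b' j| := by
  have hcont : Continuous fun b : Fin p → ℝ =>
      l2norm (X.mulVec b - y) ^ 2 - 2 * γ * ∑ j, |b j| := by
    have h1 : Continuous fun b : Fin p → ℝ => l2norm (X.mulVec b - y) :=
      continuous_l2norm.comp ((continuous_const.matrix_mulVec continuous_id).sub continuous_const)
    fun_prop
  refine hcont.exists_forall_le (Filter.tendsto_atTop_mono (f := fun b : Fin p → ℝ =>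
    ‖b‖ + -(l2norm y ^ 2 + ((2 * γ + 1) * K) ^ 2 / 2)) (fun b => ?_)
    (Filter.tendsto_atTop_add_const_right _ _ (tendsto_norm_cocompact_atTop)))
  have hnorm : ‖b‖ ≤ ∑ j, |b j| :=
    (pi_norm_le_iff_of_nonneg (Finset.sum_nonneg fun _ _ => abs_nonneg _)).2 fun j =>
      Finset.single_le_sum (f := fun j => |b j|) (fun _ _ => abs_nonneg _) (Finset.mem_univ j)
  have hsplit := l2norm_add_sq (X.mulVec b - y) y
  rw [sub_add_cancel] at hsplit
  have hcs := dotProduct_le_l2norm_mul (X.mulVec b - y) y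
  have hb := hK b
  have h2 := mul_le_mul_of_nonneg_left hb (by linarith : 0 ≤ 2 * γ + 1)
  nlinarith [sq_nonneg (l2norm (X.mulVec b - y) - l2norm y),
    sq_nonneg (l2norm (X.mulVec b) - (2 * γ + 1) * K)]

/-- Comparing the minimizers for the responses `X bs + e` and `X bs` of least squares minus a
multiple of the `ℓ¹` norm, where `X w` is the projection of `e` on the range of `X`. -/
lemma sum_abs_add_le_of_minimizers {X : Matrix (Fin n) (Fin p) ℝ} {bs b b₀ w : Fin p → ℝ}
    {e : Fin n → ℝ} {γ : ℝ} (hγ : 0 < γ)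
    (hb : ∀ b' : Fin p → ℝ, l2norm (X.mulVec b - (X.mulVec bs + e)) ^ 2 - 2 * γ * ∑ j, |b j| ≤
      l2norm (X.mulVec b' - (X.mulVec bs + e)) ^ 2 - 2 * γ * ∑ j, |b' j|)
    (hb₀ : ∀ b' : Fin p → ℝ, l2norm (X.mulVec b₀ - X.mulVec bs) ^ 2 - 2 * γ * ∑ j, |b₀ j| ≤
      l2norm (X.mulVec b' - X.mulVec bs) ^ 2 - 2 * γ * ∑ j, |b' j|)
    (hw : ∀ u, X.mulVec w ⬝ᵥ X.mulVec u = e ⬝ᵥ X.mulVec u) :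
    ∑ j, |(b₀ + w) j| + ∑ j, |(b - w) j| ≤ ∑ j, |b j| + ∑ j, |b₀ j| := by
  have h1 := hb (b₀ + w)
  have h2 := hb₀ (b - w)
  have hwb := hw b
  have hwb₀ := hw b₀
  have hww := hw w
  have hwbs := hw bs
  simp only [l2norm_sq_eq_dotProduct, Matrix.mulVec_add, Matrix.mulVec_sub, dotProduct_add,
    dotProduct_sub, add_dotProduct, sub_dotProduct] at h1 h2
  have h3 : 2 * γ * (∑ j, |(b₀ + w) j| + ∑ j, |(b - w) j|)
      ≤ 2 * γ * (∑ j, |b j| + ∑ j, |b₀ j|) := by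
    linarith [dotProduct_comm (X.mulVec w) (X.mulVec b), dotProduct_comm (X.mulVec w) (X.mulVec b₀),
      dotProduct_comm (X.mulVec w) (X.mulVec bs), dotProduct_comm (X.mulVec b) (X.mulVec b₀),
      dotProduct_comm (X.mulVec b) (X.mulVec bs), dotProduct_comm (X.mulVec b₀) (X.mulVec bs),
      dotProduct_comm e (X.mulVec w), dotProduct_comm e (X.mulVec b),
      dotProduct_comm e (X.mulVec b₀), dotProduct_comm e (X.mulVec bs)]
  exact le_of_mul_le_mul_left h3 (by linarith)

lemma integrable_l2norm_noise {Ω : Type*} [MeasurableSpace Ω] {P : Measure Ω} {v : ℝ≥0}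
    {ε : Ω → Fin n → ℝ} (hmeas : Measurable ε)
    (hgauss : Measure.map ε P = Measure.pi fun _ : Fin n => gaussianReal 0 v) :
    Integrable (fun ω => l2norm (ε ω)) P := by
  have h : Integrable (l2norm : (Fin n → ℝ) → ℝ) (Measure.map ε P) := by
    rw [hgauss]
    refine Integrable.mono' (g := fun g => ∑ i, |g i|)
      (integrable_finsetSum _ fun i _ => (integrable_eval_pi_gaussianReal v i).abs)
      continuous_l2norm.aestronglyMeasurable (Filter.Eventually.of_forall fun g => ?_)
    rw [Real.norm_eq_abs, abs_of_nonneg (l2norm_nonneg g)]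
    exact l2norm_le_sum_abs g
  exact h.comp_measurable hmeas

lemma integrable_prediction_error {X : Matrix (Fin n) (Fin p) ℝ} {bs : Fin p → ℝ}
    {Ω : Type*} [MeasurableSpace Ω] {P : Measure Ω} [IsProbabilityMeasure P] {v : ℝ≥0}
    {ε : Ω → Fin n → ℝ} (hmeas : Measurable ε)
    (hgauss : Measure.map ε P = Measure.pi fun _ : Fin n => gaussianReal 0 v)
    {bhat : Ω → Fin p → ℝ} (hbmeas : Measurable bhat) {C : ℝ}
    (h : ∀ ω, l2norm (X.mulVec (bhat ω - bs)) ≤ 2 * l2norm (ε ω) + C) :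
    Integrable (fun ω => l2norm (X.mulVec (bhat ω - bs))) P := by
  have hc : Continuous fun b : Fin p → ℝ => l2norm (X.mulVec (b - bs)) :=
    continuous_l2norm.comp (continuous_const.matrix_mulVec (continuous_id.sub continuous_const))
  refine Integrable.mono' (((integrable_l2norm_noise hmeas hgauss).const_mul 2).add
    (integrable_const C)) (hc.measurable.comp hbmeas).aestronglyMeasurable
    (Filter.Eventually.of_forall fun ω => ?_)
  rw [Real.norm_eq_abs, abs_of_nonneg (l2norm_nonneg _)]
  exact h ω

lemma sum_abs_add_smul_le (b u : Fin p → ℝ) {t : ℝ} (ht : 0 < t) :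
    ∑ j, |(b + t • u) j| ≤ ∑ j, |b j| + t * ∑ j, |u j| := by
  rw [Finset.mul_sum, ← Finset.sum_add_distrib]
  refine Finset.sum_le_sum fun j _ => (abs_add_le _ _).trans ?_
  rw [Pi.smul_apply, smul_eq_mul, abs_mul, abs_of_pos ht]

/-- The noise barrier for a nonnegative penalty level. -/
lemma noise_le_of_minimizer {X : Matrix (Fin n) (Fin p) ℝ} {bs b : Fin p → ℝ} {e : Fin n → ℝ}
    {c : ℝ} (hc : 0 ≤ c)
    (hmin : ∀ b' : Fin p → ℝ, l2norm (X.mulVec b - (X.mulVec bs + e)) ^ 2 + 2 * (c * ∑ j, |b j|) ≤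
      l2norm (X.mulVec b' - (X.mulVec bs + e)) ^ 2 + 2 * (c * ∑ j, |b' j|)) (u : Fin p → ℝ) :
    X.mulVec u ⬝ᵥ e - c * ∑ j, |u j| ≤ l2norm (X.mulVec (b - bs)) * l2norm (X.mulVec u) := by
  refine (noise_sub_le_of_minimizer hmin fun t ht => ?_).trans (dotProduct_le_l2norm_mul _ _)
  have := mul_le_mul_of_nonneg_left (sum_abs_add_smul_le b u ht) hc
  linarith

lemma l2norm_mulVec_sub_le_of_minimizer {X : Matrix (Fin n) (Fin p) ℝ} {bs b : Fin p → ℝ}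
    {e : Fin n → ℝ} {c : ℝ} (hc : 0 ≤ c)
    (hmin : ∀ b' : Fin p → ℝ, l2norm (X.mulVec b - (X.mulVec bs + e)) ^ 2 + 2 * (c * ∑ j, |b j|) ≤
      l2norm (X.mulVec b' - (X.mulVec bs + e)) ^ 2 + 2 * (c * ∑ j, |b' j|)) :
    l2norm (X.mulVec (b - bs)) ≤ 2 * l2norm e + (1 + 2 * (c * ∑ j, |bs j|)) := by
  have h := hmin bs
  have hB : 0 ≤ c * ∑ j, |bs j| := mul_nonneg hc (Finset.sum_nonneg fun _ _ => abs_nonneg _)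
  have hb : 0 ≤ c * ∑ j, |b j| := mul_nonneg hc (Finset.sum_nonneg fun _ _ => abs_nonneg _)
  have e1 : X.mulVec (b - bs) = (X.mulVec b - (X.mulVec bs + e)) + e := by
    rw [Matrix.mulVec_sub]
    abel
  have e2 : X.mulVec bs - (X.mulVec bs + e) = -e := by abel
  have e3 : l2norm (-e) = l2norm e := by simp [l2norm]
  rw [e2, e3] at h
  have hsplit := l2norm_add_sq (X.mulVec b - (X.mulVec bs + e)) e
  have hcs := dotProduct_le_l2norm_mul (X.mulVec (b - bs)) e
  have e4 : (X.mulVec b - (X.mulVec bs + e)) ⬝ᵥ e = X.mulVec (b - bs) ⬝ᵥ e - l2norm e ^ 2 := by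
    rw [e1, add_dotProduct, l2norm_sq_eq_dotProduct]
    ring
  rw [← e1, e4] at hsplit
  have h0 := l2norm_nonneg (X.mulVec (b - bs))
  have h1 := l2norm_nonneg e
  by_contra! hlt
  nlinarith

/-- Least squares minus a multiple of the `ℓ¹` norm has a minimizer only for injective designs. -/
lemma eq_zero_of_mulVec_eq_zero_of_minimizer {X : Matrix (Fin n) (Fin p) ℝ} {y : Fin n → ℝ}
    {b : Fin p → ℝ} {γ : ℝ} (hγ : 0 < γ)
    (hb : ∀ b' : Fin p → ℝ, l2norm (X.mulVec b - y) ^ 2 - 2 * γ * ∑ j, |b j| ≤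
      l2norm (X.mulVec b' - y) ^ 2 - 2 * γ * ∑ j, |b' j|)
    {v : Fin p → ℝ} (hv : X.mulVec v = 0) : v = 0 := by
  by_contra hne
  obtain ⟨j₀, hj₀⟩ := Function.ne_iff.1 hne
  have hV : 0 < ∑ j, |v j| :=
    Finset.sum_pos' (fun _ _ => abs_nonneg _) ⟨j₀, Finset.mem_univ _, abs_pos.2 hj₀⟩
  set B := ∑ j, |b j| with hB
  set t := (2 * B + 1) / ∑ j, |v j| with ht
  have hB0 : 0 ≤ B := Finset.sum_nonneg fun _ _ => abs_nonneg _
  have ht0 : 0 < t := div_pos (by linarith) hV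
  have h := hb (b + t • v)
  rw [Matrix.mulVec_add, Matrix.mulVec_smul, hv, smul_zero, add_zero] at h
  have h1 : ∑ j, |(b + t • v) j| ≤ B := by
    refine le_of_mul_le_mul_left ?_ (by linarith : 0 < 2 * γ)
    linarith
  have h2 : t * ∑ j, |v j| ≤ ∑ j, |(b + t • v) j| + B := by
    rw [Finset.mul_sum, hB, ← Finset.sum_add_distrib]
    refine Finset.sum_le_sum fun j _ => ?_
    have := abs_sub (b j + t * v j) (b j)
    rw [add_sub_cancel_left, abs_mul, abs_of_pos ht0] at this
    exact this
  rw [ht, div_mul_cancel₀ _ hV.ne'] at h2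
  linarith

/-- For a negative penalty level the prediction error dominates, up to an odd function of the
noise, the norm of the projection of the noise on the range of the design. -/
lemma exists_dominating_of_minimizers {X : Matrix (Fin n) (Fin p) ℝ} {bs : Fin p → ℝ}
    {Ω : Type*} [MeasurableSpace Ω] {P : Measure Ω} [IsProbabilityMeasure P] {v : ℝ≥0}
    {ε : Ω → Fin n → ℝ} (hmeas : Measurable ε)
    (hgauss : Measure.map ε P = Measure.pi fun _ : Fin n => gaussianReal 0 v)
    {γ : ℝ} (hγ : 0 < γ) {bhat : Ω → Fin p → ℝ} (hbmeas : Measurable bhat)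
    (hmin : ∀ ω, ∀ b' : Fin p → ℝ,
      l2norm (X.mulVec (bhat ω) - (X.mulVec bs + ε ω)) ^ 2 - 2 * γ * ∑ j, |bhat ω j| ≤
        l2norm (X.mulVec b' - (X.mulVec bs + ε ω)) ^ 2 - 2 * γ * ∑ j, |b' j|) :
    ∃ R : Ω → ℝ, Integrable R P ∧ (∀ ω, 0 ≤ R ω) ∧
      (∀ ω u, X.mulVec u ⬝ᵥ ε ω ≤ R ω * l2norm (X.mulVec u)) ∧
      ∫ ω, R ω ∂P ≤ ∫ ω, l2norm (X.mulVec (bhat ω - bs)) ∂P := by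
  obtain ⟨ω₀⟩ : Nonempty Ω := P.nonempty_of_neZero
  obtain ⟨A, hAX, hA⟩ := exists_pseudoinverse
    (fun v hv => eq_zero_of_mulVec_eq_zero_of_minimizer hγ (hmin ω₀) hv)
  obtain ⟨C, hC0, hC⟩ := exists_l2norm_mulVec_le A
  set K : ℝ := p * C with hKdef
  have hK0 : 0 ≤ K := by positivity
  have hK : ∀ b : Fin p → ℝ, ∑ j, |b j| ≤ K * l2norm (X.mulVec b) := fun b => by
    have h1 := hC (X.mulVec b)
    rw [hAX] at h1
    have h2 := mul_le_mul_of_nonneg_left h1 (Nat.cast_nonneg (α := ℝ) p)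
    have h3 := sum_abs_le_mul_l2norm b
    linarith
  obtain ⟨b₀, hb₀⟩ := exists_minimizer hK (X.mulVec bs) hγ.le
  obtain ⟨s₀, hs₀, hs₀u⟩ := exists_sign_vector b₀
  let φ : (Fin n → ℝ) → ℝ := fun g => γ * (s₀ ⬝ᵥ A.mulVec g) / l2norm (X.mulVec (A.mulVec g))
  let ψ : (Fin n → ℝ) → ℝ := fun g => l2norm (X.mulVec (A.mulVec g))
  have hAc : Continuous fun g : Fin n → ℝ => A.mulVec g :=
    continuous_const.matrix_mulVec continuous_id
  have hψc : Continuous ψ := continuous_l2norm.comp (continuous_const.matrix_mulVec hAc)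
  have hφm : Measurable φ :=
    ((continuous_const.mul (continuous_const.dotProduct hAc)).measurable).div hψc.measurable
  have hφb : ∀ g, |φ g| ≤ γ * K := fun g => by
    have h1 : |s₀ ⬝ᵥ A.mulVec g| ≤ K * ψ g := by
      refine (abs_le.2 ⟨?_, hs₀u _⟩).trans (hK _)
      have h := hs₀u (-A.mulVec g)
      simp only [dotProduct_neg, Pi.neg_apply, abs_neg] at h
      linarith
    rw [abs_div, abs_mul, abs_of_pos hγ, abs_of_nonneg (l2norm_nonneg _)]
    refine div_le_of_le_mul₀ (l2norm_nonneg _) (by positivity) ?_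
    rw [mul_assoc]
    exact mul_le_mul_of_nonneg_left h1 hγ.le
  have hφodd : ∀ g, φ (-g) = -φ g := fun g => by
    have e : ∀ v : Fin n → ℝ, l2norm (-v) = l2norm v := fun v => by simp [l2norm]
    simp only [φ, Matrix.mulVec_neg, dotProduct_neg, e, mul_neg, neg_div]
  have hφint : Integrable (fun ω => φ (ε ω)) P :=
    Integrable.of_bound (hφm.comp hmeas).aestronglyMeasurable (γ * K)
      (Filter.Eventually.of_forall fun ω => hφb _)
  have hφ0 : ∫ ω, φ (ε ω) ∂P = 0 := by
    rw [← integral_map hmeas.aemeasurable hφm.aestronglyMeasurable, hgauss]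
    exact integral_pi_gaussianReal_eq_zero_of_odd hφodd
  have hψsq : ∀ g, ψ g ^ 2 = g ⬝ᵥ X.mulVec (A.mulVec g) := fun g => by
    rw [l2norm_sq_eq_dotProduct, hA]
  have hψle : ∀ g, ψ g ≤ l2norm g := fun g => by
    have h := dotProduct_le_l2norm_mul g (X.mulVec (A.mulVec g))
    rw [← hψsq] at h
    change ψ g ^ 2 ≤ l2norm g * ψ g at h
    have h1 : 0 ≤ ψ g := l2norm_nonneg _
    have h2 := l2norm_nonneg g
    by_contra! hlt
    nlinarith
  have hψint : Integrable (fun ω => ψ (ε ω)) P :=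
    Integrable.mono' (integrable_l2norm_noise hmeas hgauss)
      (hψc.measurable.comp hmeas).aestronglyMeasurable
      (Filter.Eventually.of_forall fun ω => by
        rw [Real.norm_eq_abs, abs_of_nonneg (l2norm_nonneg _)]
        exact hψle _)
  have hstat : ∀ ω, ∃ s : Fin p → ℝ, s ⬝ᵥ bhat ω = ∑ j, |bhat ω j| ∧
      (∀ u, s ⬝ᵥ u ≤ ∑ j, |u j|) ∧
      ∀ u, X.mulVec u ⬝ᵥ ε ω + γ * (s ⬝ᵥ u) ≤ X.mulVec (bhat ω - bs) ⬝ᵥ X.mulVec u := by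
    intro ω
    obtain ⟨s, hs, hsu⟩ := exists_sign_vector (bhat ω)
    refine ⟨s, hs, hsu, fun u => ?_⟩
    have h := noise_sub_le_of_minimizer (X := X) (bs := bs) (b := bhat ω) (e := ε ω) (c := -γ)
      (fun b' => by linarith [hmin ω b']) (u := u) (D := -γ * (s ⬝ᵥ u)) fun t _ => by
        have h1 := mul_le_mul_of_nonneg_left (hsu (bhat ω + t • u)) hγ.le
        rw [dotProduct_add, hs, dotProduct_smul, smul_eq_mul] at h1
        linarith
    linarith
  have h_int : Integrable (fun ω => l2norm (X.mulVec (bhat ω - bs))) P := by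
    refine integrable_prediction_error hmeas hgauss hbmeas (C := γ * K) fun ω => ?_
    obtain ⟨s, -, hsu, hst⟩ := hstat ω
    set Δ := bhat ω - bs
    have h := hst (-Δ)
    simp only [Matrix.mulVec_neg, neg_dotProduct, dotProduct_neg, ← l2norm_sq_eq_dotProduct] at h
    have h1 := dotProduct_le_l2norm_mul (X.mulVec Δ) (ε ω)
    have h2 := mul_le_mul_of_nonneg_left ((hsu Δ).trans (hK Δ)) hγ.le
    have h3 := l2norm_nonneg (X.mulVec Δ)
    have h4 := l2norm_nonneg (ε ω)
    have h5 : 0 ≤ γ * K := by positivity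
    by_contra! hlt
    nlinarith
  have hpt : ∀ ω, ψ (ε ω) + φ (ε ω) ≤ l2norm (X.mulVec (bhat ω - bs)) := by
    intro ω
    obtain ⟨s, hs, hsu, hst⟩ := hstat ω
    set w := A.mulVec (ε ω) with hw
    have hsum := sum_abs_add_le_of_minimizers hγ (hmin ω) hb₀ (hA (ε ω))
    have h1 := hs₀u (b₀ + w)
    have h2 := hsu (bhat ω - w)
    rw [dotProduct_add, hs₀] at h1
    rw [dotProduct_sub, hs] at h2
    have h3 := mul_le_mul_of_nonneg_left (show s₀ ⬝ᵥ w ≤ s ⬝ᵥ w by linarith) hγ.le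
    have h4 := hst w
    rw [dotProduct_comm, ← hψsq] at h4
    have h5 := dotProduct_le_l2norm_mul (X.mulVec (bhat ω - bs)) (X.mulVec w)
    change _ ≤ _ * ψ (ε ω) at h5
    change ψ (ε ω) + γ * (s₀ ⬝ᵥ w) / ψ (ε ω) ≤ _
    rcases (l2norm_nonneg (X.mulVec w)).eq_or_lt with h0 | h0
    · change 0 = ψ (ε ω) at h0
      rw [← h0, div_zero, add_zero]
      exact l2norm_nonneg _
    · change 0 < ψ (ε ω) at h0
      refine le_of_mul_le_mul_right ?_ h0
      rw [add_mul, div_mul_cancel₀ _ h0.ne']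
      linarith
  refine ⟨fun ω => ψ (ε ω), hψint, fun ω => l2norm_nonneg _, fun ω u => ?_, ?_⟩
  · rw [dotProduct_comm, ← hA]
    exact dotProduct_le_l2norm_mul _ _
  · have h := integral_mono (hψint.add hφint) h_int hpt
    simp only [Pi.add_apply] at h
    rw [integral_add hψint hφint, hφ0, add_zero] at h
    exact h

lemma pos_of_ripConst_lt_one {X : Matrix (Fin n) (Fin p) ℝ} {s : ℕ} (hs : 1 ≤ s) (hp : 0 < p)
    (hδ : 0 < 1 - ripConst X s) : 0 < n := by
  rcases Nat.eq_zero_or_pos n with rfl | hn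
  · have hsupp : Set.ncard {l | (Pi.single ⟨0, hp⟩ (1 : ℝ) : Fin p → ℝ) l ≠ 0} ≤ s := by
      refine (Set.ncard_le_ncard (t := {⟨0, hp⟩}) (fun l hl => ?_) (Set.toFinite _)).trans
        (by simpa using hs)
      by_contra h
      exact hl (Pi.single_eq_of_ne h _)
    have h := ((ripConst_spec X s).2 _ hsupp).1
    have hnorm : l2norm (Pi.single ⟨0, hp⟩ (1 : ℝ) : Fin p → ℝ) ^ 2 = 1 := by
      rw [l2norm_sq_eq_dotProduct]
      simp
    have hpos : 0 < l2norm (Pi.single ⟨0, hp⟩ (1 : ℝ) : Fin p → ℝ) :=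
      lt_of_le_of_ne (l2norm_nonneg _) fun h0 => by rw [← h0] at hnorm; norm_num at hnorm
    rw [Nat.cast_zero, Real.sqrt_zero, div_zero] at h
    exact absurd h (not_le.2 (mul_pos hδ hpos))
  · exact hn

end Lasso

end LassoNoiseBarrier

open LassoNoiseBarrier in
/-- if the Lasso tuning parameter is too small,
`λ ≤ ((1-δ_{2d})/8)·σ·√(log(p/(5d)))`, then for any target `β*` the expected prediction
error is at least `((1-δ_{2d})/(8(1+δ_d)))·σ·√(d·log(p/(5d)))`. -/
theorem lasso_small_tuning_lower_bound {n p : ℕ} (X : Matrix (Fin n) (Fin p) ℝ)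
    (bs : Fin p → ℝ)
    {Ω : Type*} [MeasurableSpace Ω] (P : Measure Ω) [IsProbabilityMeasure P]
    (σ : ℝ≥0) (hσ : 0 < σ) (ε : Ω → Fin n → ℝ) (hmeas : Measurable ε)
    (hgauss : Measure.map ε P = Measure.pi fun _ : Fin n => gaussianReal 0 (σ ^ 2))
    (lam : ℝ) (d : ℕ) (hd : 1 ≤ d) (hdp : 5 * d < p)
    (hlam : lam ≤ (1 - ripConst X (2 * d)) / 8 * σ * Real.sqrt (Real.log (p / (5 * d))))
    (bhat : Ω → Fin p → ℝ) (hbmeas : Measurable bhat)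
    (hmin : ∀ ω : Ω, ∀ b : Fin p → ℝ,
      l2norm (X.mulVec (bhat ω) - (X.mulVec bs + ε ω)) ^ 2 +
          2 * (Real.sqrt n * lam * ∑ j, |bhat ω j|) ≤
        l2norm (X.mulVec b - (X.mulVec bs + ε ω)) ^ 2 +
          2 * (Real.sqrt n * lam * ∑ j, |b j|)) :
    (1 - ripConst X (2 * d)) / (8 * (1 + ripConst X d)) * σ *
        Real.sqrt (d * Real.log (p / (5 * d))) ≤
      ∫ ω, l2norm (X.mulVec (bhat ω - bs)) ∂P := by
  rcases le_or_gt (1 - ripConst X (2 * d)) 0 with hδ | hδ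
  · have h1 := (ripConst_spec X d).1
    refine le_trans ?_ (integral_nonneg fun ω => l2norm_nonneg _)
    exact mul_nonpos_of_nonpos_of_nonneg (mul_nonpos_of_nonpos_of_nonneg
      (div_nonpos_of_nonpos_of_nonneg hδ (by positivity)) σ.coe_nonneg) (Real.sqrt_nonneg _)
  have hn : 0 < n := pos_of_ripConst_lt_one (by omega) (by omega) hδ
  have hsn : 0 < Real.sqrt n := Real.sqrt_pos.2 (by exact_mod_cast hn)
  rcases le_or_gt 0 lam with hl | hl
  · have hc : 0 ≤ Real.sqrt n * lam := mul_nonneg hsn.le hl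
    exact le_integral_of_forall_noise_le X hσ hmeas hgauss hd hdp hn hδ hlam
      (integrable_prediction_error hmeas hgauss hbmeas fun ω =>
        l2norm_mulVec_sub_le_of_minimizer hc (hmin ω))
      (fun ω => l2norm_nonneg _) fun ω u => noise_le_of_minimizer hc (hmin ω) u
  · obtain ⟨R, hR, hR0, hdom, hle⟩ := exists_dominating_of_minimizers (γ := -(Real.sqrt n * lam))
      hmeas hgauss (neg_pos.2 (mul_neg_of_pos_of_neg hsn hl)) hbmeas
      (fun ω b' => by linarith [hmin ω b'])
    refine (le_integral_of_forall_noise_le X hσ hmeas hgauss hd hdp hn hδ (lam := 0) ?_ hR hR0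
      fun ω u => ?_).trans hle
    · positivity
    · rw [mul_zero, zero_mul, sub_zero]
      exact hdom ω u
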